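/- Let 1 < p < ∞ and n ∈ ℕ. The set A of n-tuples (x_1,…,x_n) ∈ (ℓ_p)^n that do not have Property K is a closed, Haar null, nowhere dense subset of the Banach space (ℓ_p)^n. -/

import Mathlib

open MeasureTheory
open scoped ENNReal
noncomputable section

/-- The index set of pairs `(i,j)` with `i < j`, indexing the coordinates of
`ℝ^{n(n-1)/2}`. -/
abbrev PairIdx (n : ℕ) := {q : Fin n × Fin n // q.1 < q.2}

/-- `‖v‖_p` for `v ∈ ℝ^n`. -/
def pNorm (p : ℝ) {n : ℕ} (v : Fin n → ℝ) : ℝ := (∑ k, |v k| ^ p) ^ (1 / p)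

/-- The map `F_n : (ℝ^n)^n → ℝ^{n(n-1)/2}`, `F_n(x₁,…,xₙ) = (‖x_i - x_j‖_p^p)_{i<j}`. -/
def Fmap (p : ℝ) (n : ℕ) (x : Fin n → Fin n → ℝ) : PairIdx n → ℝ :=
  fun q => ∑ k, |x q.val.1 k - x q.val.2 k| ^ p

/-- `G_n`: the set of points of `(ℝ^n)^n` where the derivative of `F_n` has full rank
`n(n-1)/2`. -/
def Gset (p : ℝ) (n : ℕ) : Set (Fin n → Fin n → ℝ) :=
  {x | LinearMap.rank (fderiv ℝ (Fmap p n) x).toLinearMap = ((n * (n - 1) / 2 : ℕ) : Cardinal)}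

/-- Property K for an `n`-tuple of points of `ℓ_p` (given by their coordinates). -/
def PropertyKSeq (p : ℝ) (n : ℕ) (x : Fin n → ℕ → ℝ) : Prop :=
  ∃ m : Fin n → ℕ, StrictMono m ∧ (fun i j => x i (m j)) ∈ Gset p n

/-- Property K for an `n`-tuple of points of `ℓ_p^N`. -/
def PropertyKFin (p : ℝ) (n N : ℕ) (x : Fin n → Fin N → ℝ) : Prop :=
  ∃ m : Fin n → Fin N, StrictMono m ∧ (fun i j => x i (m j)) ∈ Gset p n

/-- A Borel set `A` in a (separable) Banach space is Haar null if there is a Borel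
probability measure `μ` with `μ(x + A) = 0` for all `x`. -/
def HaarNull {X : Type*} [AddGroup X] [MeasurableSpace X] (A : Set X) : Prop :=
  ∃ μ : Measure X, IsProbabilityMeasure μ ∧ ∀ x : X, μ ((fun a => x + a) '' A) = 0

/-- `X` uniformly contains the spaces `ℓ_p^m`, `m ∈ ℕ`. -/
def UnifContainsLp (p : ℝ≥0∞) [Fact (1 ≤ p)] (X : Type*) [NormedAddCommGroup X]
    [NormedSpace ℝ X] : Prop :=
  ∃ C : ℝ, 1 ≤ C ∧ ∀ m : ℕ, ∃ (Y : Submodule ℝ X)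
    (T : PiLp p (fun _ : Fin m => ℝ) ≃L[ℝ] Y),
      ‖(T : PiLp p (fun _ : Fin m => ℝ) →L[ℝ] Y)‖ *
        ‖(T.symm : Y →L[ℝ] PiLp p (fun _ : Fin m => ℝ))‖ ≤ C

lemma card_pairIdx (n : ℕ) : Fintype.card (PairIdx n) = n * (n - 1) / 2 := by
  rw [← Finset.sum_range_id_mul_two, Nat.mul_div_cancel _ two_pos, Fintype.card_subtype,
    ← Fin.sum_univ_eq_sum_range (fun k => k) n, ← Finset.univ_product_univ,
    Finset.card_filter, Finset.sum_product_right]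
  refine Finset.sum_congr rfl fun j _ => ?_
  rw [← Finset.card_filter, Finset.filter_gt_eq_Iio, Fin.card_Iio]

lemma rank_pairIdx (n : ℕ) :
    Module.rank ℝ (PairIdx n → ℝ) = ((n * (n - 1) / 2 : ℕ) : Cardinal) := by
  rw [rank_fun', card_pairIdx]

lemma contDiff_Fmap {p : ℝ} (hp : 1 < p) (n : ℕ) : ContDiff ℝ 1 (Fmap p n) := by
  unfold Fmap
  refine contDiff_pi.2 fun q => ContDiff.sum fun k _ => ?_
  exact ContDiff.norm_rpow (f := fun x : Fin n → Fin n → ℝ => x q.val.1 k - x q.val.2 k)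
    (by fun_prop) hp

lemma isOpen_Gset {p : ℝ} (hp : 1 < p) (n : ℕ) : IsOpen (Gset p n) := by
  have hG : Gset p n = fderiv ℝ (Fmap p n) ⁻¹'
      {f | ((n * (n - 1) / 2 : ℕ) : Cardinal) ≤ LinearMap.rank f.toLinearMap} := by
    ext x
    exact ⟨fun h => h.ge, fun h => le_antisymm
      ((LinearMap.rank_le_range _).trans_eq (rank_pairIdx n)) h⟩
  rw [hG]
  exact (isOpen_setOfPred_nat_le_rank _).preimage
    ((contDiff_Fmap hp n).continuous_fderiv one_ne_zero)

lemma smul_mem_Gset {p : ℝ} (hp : 1 < p) {n : ℕ} {c : ℝ} (hc : 0 < c)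
    {x : Fin n → Fin n → ℝ} (hx : x ∈ Gset p n) : c • x ∈ Gset p n := by
  have hF : (Fmap p n <| c • ·) = c ^ p • Fmap p n := by
    ext y q
    simp only [Fmap, Pi.smul_apply, smul_eq_mul, Finset.mul_sum, ← mul_sub, abs_mul,
      abs_of_pos hc]
    exact Finset.sum_congr rfl fun k _ => Real.mul_rpow hc.le (abs_nonneg _)
  have h1 := fderiv_comp_smul (𝕜 := ℝ) (f := Fmap p n) (x := x) c
  rw [hF, fderiv_const_smul ((contDiff_Fmap hp n).differentiable one_ne_zero x)] at h1
  have h2 := congrArg (fun f => LinearMap.range f.toLinearMap) h1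
  simp only [ContinuousLinearMap.toLinearMap_smul] at h2
  rw [LinearMap.range_smul _ _ (Real.rpow_pos_of_pos hc p).ne',
    LinearMap.range_smul _ _ hc.ne'] at h2
  simp only [Gset, Set.mem_ofPred_eq, LinearMap.rank] at hx ⊢
  rw [← h2, hx]

lemma fderiv_Fmap_apply {p : ℝ} (hp : 1 < p) {n : ℕ} (x h : Fin n → Fin n → ℝ)
    (q : PairIdx n) :
    fderiv ℝ (Fmap p n) x h q = ∑ k, p * |x q.val.1 k - x q.val.2 k| ^ (p - 2) *
      (x q.val.1 k - x q.val.2 k) * (h q.val.1 k - h q.val.2 k) := by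
  have h0 := (((contDiff_Fmap hp n).differentiable one_ne_zero x).hasFDerivAt)
  have hl : HasDerivAt (fun t : ℝ => x + t • h) h 0 := by
    simpa using ((hasDerivAt_id (0 : ℝ)).smul_const h).const_add x
  have h1 := (HasFDerivAt.comp_hasDerivAt_of_eq (0 : ℝ) h0 hl (by simp))
  have h2 := hasDerivAt_pi.1 h1 q
  refine h2.unique ?_
  simp only [Function.comp_def, Fmap]
  refine HasDerivAt.fun_sum fun k _ => ?_
  have h3 : HasDerivAt (fun t : ℝ => (x + t • h) q.val.1 k - (x + t • h) q.val.2 k)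
      (h q.val.1 k - h q.val.2 k) 0 :=
    (hasDerivAt_pi.1 (hasDerivAt_pi.1 hl _) k).sub (hasDerivAt_pi.1 (hasDerivAt_pi.1 hl _) k)
  have h4 := hasDerivAt_abs_rpow (x q.val.1 k - x q.val.2 k) hp
  exact h4.comp_of_eq (0 : ℝ) h3 (by simp)

lemma one_mem_Gset {p : ℝ} (hp : 1 < p) (n : ℕ) :
    (fun i k : Fin n => if i = k then (1 : ℝ) else 0) ∈ Gset p n := by
  have hsurj : Function.Surjective
      (fderiv ℝ (Fmap p n) (fun i k : Fin n => if i = k then (1 : ℝ) else 0)).toLinearMap := by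
    intro v
    refine ⟨fun i j => if hij : i < j then - v ⟨(i, j), hij⟩ / p else 0, ?_⟩
    ext ⟨⟨i, j⟩, hij⟩
    replace hij : i < j := hij
    rw [ContinuousLinearMap.coe_coe, fderiv_Fmap_apply hp]
    simp only
    have key : ∀ k : Fin n, p * |(if i = k then (1 : ℝ) else 0) - (if j = k then (1 : ℝ) else 0)|
        ^ (p - 2) * ((if i = k then (1 : ℝ) else 0) - (if j = k then (1 : ℝ) else 0)) =
        (if i = k then p else 0) - (if j = k then p else 0) := by
      intro k
      by_cases hi : i = k
      · have hj : j ≠ k := hi ▸ hij.ne'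
        simp [hi, hj]
      · by_cases hj : j = k <;> simp [hi, hj]
    simp only [key, sub_mul, ite_mul, zero_mul, Finset.sum_sub_distrib, Finset.sum_ite_eq,
      Finset.mem_univ, if_true, lt_irrefl, dite_false, hij, hij.not_gt, dite_true]
    field_simp
    ring
  exact (rank_range_of_surjective _ hsurj).trans (rank_pairIdx n)

lemma exists_pos_forall_mem_Gset {p : ℝ} (hp : 1 < p) (n : ℕ) : ∃ δ > 0, ∀ c > 0,
    ∀ z : Fin n → Fin n → ℝ, (∀ i k, |z i k - if i = k then c else 0| < c * δ) →
      z ∈ Gset p n := by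
  obtain ⟨δ, hδ, hball⟩ := Metric.isOpen_iff.1 (isOpen_Gset hp n) _ (one_mem_Gset hp n)
  refine ⟨δ, hδ, fun c hc z hz => ?_⟩
  rw [← smul_inv_smul₀ hc.ne' z]
  refine smul_mem_Gset hp hc (hball ?_)
  refine (dist_pi_lt_iff hδ).2 fun i => (dist_pi_lt_iff hδ).2 fun k => ?_
  have h1 : (c⁻¹ • z) i k - (if i = k then 1 else 0) = c⁻¹ * (z i k - if i = k then c else 0) := by
    split_ifs <;> simp [mul_sub, hc.ne']
  rw [Real.dist_eq, h1, abs_mul, abs_of_pos (inv_pos.2 hc), inv_mul_lt_iff₀ hc]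
  exact hz i k

/-- Three-parameter injective enumeration of coordinates, strictly increasing in the last
parameter. -/
def blockPos (m a j : ℕ) : ℕ := Nat.pair m (Nat.pair a j)

lemma blockPos_inj {m a j m₂ a₂ j₂ : ℕ} :
    blockPos m a j = blockPos m₂ a₂ j₂ ↔ m = m₂ ∧ a = a₂ ∧ j = j₂ := by
  simp [blockPos, Nat.pair_eq_pair]

lemma blockPos_strictMono (m a n : ℕ) : StrictMono fun j : Fin n => blockPos m a j :=
  fun _ _ h => Nat.pair_lt_pair_right _ (Nat.pair_lt_pair_right _ h)

/-- The indices `a` for which `x` is not smaller than `ε` on the coordinates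
`blockPos m a j`, `j < n`. -/
def largeBlocks {n : ℕ} (ε : ℝ) (x : Fin n → ℕ → ℝ) (m : ℕ) : Set ℕ :=
  {a | ∃ i j : Fin n, ε ≤ |x i (blockPos m a j)|}

lemma propertyKSeq_add {p : ℝ} {n : ℕ} {c δ : ℝ} (hc : 0 < c)
    (hδ : ∀ c > 0, ∀ z : Fin n → Fin n → ℝ, (∀ i k, |z i k - if i = k then c else 0| < c * δ) →
      z ∈ Gset p n) {x v : Fin n → ℕ → ℝ} {m a : ℕ} (ha : a ∉ largeBlocks (c * δ) x m)
    (hv : ∀ i j : Fin n, v i (blockPos m a j) = if i = j then c else 0) :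
    PropertyKSeq p n (fun i k => x i k + v i k) := by
  refine ⟨fun j => blockPos m a j, blockPos_strictMono m a n, hδ c hc _ fun i j => ?_⟩
  simp only [largeBlocks, Set.mem_ofPred_eq, not_exists, not_le] at ha
  simpa [hv] using ha i j

lemma card_largeBlocks_le {p : ℝ} (hp : 1 < p) {n : ℕ} {ε : ℝ} (hε : 0 < ε)
    (x : Fin n → lp (fun _ : ℕ => ℝ) (ENNReal.ofReal p)) (m : ℕ) {S : Finset ℕ}
    (hS : (S : Set ℕ) ⊆ largeBlocks ε (fun i k => x i k) m) :
    S.card * ε ^ p ≤ ∑ i, ‖x i‖ ^ p := by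
  have hp0 : 0 ≤ p := by linarith
  have htr : (ENNReal.ofReal p).toReal = p := ENNReal.toReal_ofReal hp0
  calc S.card * ε ^ p = ∑ a ∈ S, ε ^ p := by simp
    _ ≤ ∑ a ∈ S, ∑ i, ∑ j : Fin n, |x i (blockPos m a j)| ^ p := by
      refine Finset.sum_le_sum fun a ha => ?_
      obtain ⟨i, j, hij⟩ := hS ha
      calc ε ^ p ≤ |x i (blockPos m a j)| ^ p := Real.rpow_le_rpow hε.le hij hp0
        _ ≤ ∑ j : Fin n, |x i (blockPos m a j)| ^ p :=
          Finset.single_le_sum (f := fun j : Fin n => |x i (blockPos m a j)| ^ p)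
            (fun _ _ => by positivity) (Finset.mem_univ j)
        _ ≤ _ := Finset.single_le_sum
            (f := fun i : Fin n => ∑ j : Fin n, |x i (blockPos m a j)| ^ p)
            (fun _ _ => by positivity) (Finset.mem_univ i)
    _ = ∑ i, ∑ a ∈ S, ∑ j : Fin n, |x i (blockPos m a j)| ^ p := Finset.sum_comm
    _ ≤ ∑ i, ‖x i‖ ^ p := by
      refine Finset.sum_le_sum fun i _ => ?_
      rw [← Finset.sum_product' S (Finset.univ : Finset (Fin n))
        fun a j => |x i (blockPos m a j)| ^ p]
      have hinj : Set.InjOn (fun b : ℕ × Fin n => blockPos m b.1 b.2)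
          (S ×ˢ (Finset.univ : Finset (Fin n)) : Finset _) := by
        rintro ⟨a, j⟩ _ ⟨a₂, j₂⟩ _ h
        obtain ⟨-, h1, h2⟩ := blockPos_inj.1 h
        exact Prod.ext h1 (Fin.ext h2)
      have := lp.sum_rpow_le_norm_rpow (by rw [htr]; linarith) (x i)
        ((S ×ˢ (Finset.univ : Finset (Fin n))).image fun b => blockPos m b.1 b.2)
      rw [Finset.sum_image hinj, htr] at this
      exact this

lemma continuous_lp_apply (q : ℝ≥0∞) [Fact (1 ≤ q)] (k : ℕ) :
    Continuous fun f : lp (fun _ : ℕ => ℝ) q => f k :=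
  (lp.evalCLM ℝ (fun _ : ℕ => ℝ) q k).continuous

lemma isOpen_propertyKSeq {p : ℝ} (hp : 1 < p) [Fact (1 ≤ ENNReal.ofReal p)] (n : ℕ) :
    IsOpen {x : Fin n → lp (fun _ : ℕ => ℝ) (ENNReal.ofReal p) |
      PropertyKSeq p n (fun i k => x i k)} := by
  have : {x : Fin n → lp (fun _ : ℕ => ℝ) (ENNReal.ofReal p) |
      PropertyKSeq p n (fun i k => x i k)} = ⋃ m : {m : Fin n → ℕ // StrictMono m},
        (fun x i j => x i (m.1 j)) ⁻¹' Gset p n := by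
    ext x
    simp [PropertyKSeq]
  rw [this]
  refine isOpen_iUnion fun m => (isOpen_Gset hp n).preimage ?_
  exact continuous_pi fun i => continuous_pi fun j =>
    (continuous_lp_apply _ _).comp (continuous_apply i)

lemma single_blockPos_apply (q : ℝ≥0∞) {n : ℕ} (c : ℝ) (m a m₂ a₂ : ℕ) (i j : Fin n) :
    lp.single (E := fun _ : ℕ => ℝ) q (blockPos m a i) c (blockPos m₂ a₂ j) =
      if m = m₂ ∧ a = a₂ ∧ i = j then c else 0 := by
  simp only [lp.single_apply, Pi.single_apply, blockPos_inj, Fin.ext_iff, @eq_comm _ m₂,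
    @eq_comm _ a₂, @eq_comm _ (j : ℕ)]

lemma dense_propertyKSeq {p : ℝ} (hp : 1 < p) [Fact (1 ≤ ENNReal.ofReal p)] (n : ℕ) :
    Dense {x : Fin n → lp (fun _ : ℕ => ℝ) (ENNReal.ofReal p) |
      PropertyKSeq p n (fun i k => x i k)} := by
  obtain ⟨δ, hδ, hG⟩ := exists_pos_forall_mem_Gset hp n
  refine Metric.dense_iff.2 fun x ε hε => ?_
  have hc : 0 < ε / 2 := half_pos hε
  obtain ⟨a, ha⟩ : ∃ a, a ∉ largeBlocks (ε / 2 * δ) (fun i k => x i k) 0 := by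
    by_contra! h
    have hpos : 0 < (ε / 2 * δ) ^ p := by positivity
    obtain ⟨N, hN⟩ := exists_nat_gt ((∑ i, ‖x i‖ ^ p) / (ε / 2 * δ) ^ p)
    have := card_largeBlocks_le hp (mul_pos hc hδ) x 0 (S := Finset.range N) fun a _ => h a
    rw [Finset.card_range, ← le_div_iff₀ hpos] at this
    exact hN.not_ge this
  refine ⟨fun i => x i + lp.single _ (blockPos 0 a i) (ε / 2), ?_, ?_⟩
  · refine (dist_pi_lt_iff hε).2 fun i => ?_
    rw [dist_eq_norm, add_sub_cancel_left, lp.norm_single (by simpa using hp.trans' one_pos)]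
    simpa [abs_of_pos hε] using half_lt_self hε
  · exact propertyKSeq_add hc hG ha fun i j =>
      (single_blockPos_apply ..).trans (by simp)

/-- The tuple whose `i`-th member is `∑ m, 2⁻ᵐ e_{blockPos m (ω m) i}`. -/
def sparseTuple (q : ℝ≥0∞) [Fact (1 ≤ q)] (n : ℕ) (ω : ℕ → ℕ) :
    Fin n → lp (fun _ : ℕ => ℝ) q :=
  fun i => ∑' m, lp.single q (blockPos m (ω m) i) ((1 / 2 : ℝ) ^ m)

lemma norm_sparseTuple_term (q : ℝ≥0∞) [hq : Fact (1 ≤ q)] (m k : ℕ) :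
    ‖lp.single (E := fun _ : ℕ => ℝ) q k ((1 / 2 : ℝ) ^ m)‖ ≤ (1 / 2 : ℝ) ^ m := by
  rw [lp.norm_single (one_pos.trans_le hq.out)]
  simp

lemma continuous_sparseTuple (q : ℝ≥0∞) [Fact (1 ≤ q)] (n : ℕ) :
    Continuous (sparseTuple q n) :=
  continuous_pi fun i => continuous_tsum
    (fun m => (continuous_of_discreteTopology (f := fun a : ℕ =>
      lp.single (E := fun _ : ℕ => ℝ) q (blockPos m a i) ((1 / 2 : ℝ) ^ m))).comp
        (continuous_apply m))
    summable_geometric_two fun _ _ => norm_sparseTuple_term q _ _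

lemma sparseTuple_apply (q : ℝ≥0∞) [Fact (1 ≤ q)] (n : ℕ) (ω : ℕ → ℕ) (m : ℕ) (i j : Fin n) :
    sparseTuple q n ω i (blockPos m (ω m) j) = if i = j then (1 / 2 : ℝ) ^ m else 0 := by
  have hs : Summable fun m₂ => lp.single (E := fun _ : ℕ => ℝ) q (blockPos m₂ (ω m₂) i)
      ((1 / 2 : ℝ) ^ m₂) :=
    .of_norm_bounded summable_geometric_two fun _ => norm_sparseTuple_term q _ _
  have h1 := (lp.evalCLM ℝ (fun _ : ℕ => ℝ) q (blockPos m (ω m) j)).map_tsum hs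
  refine h1.trans ((tsum_eq_single m fun m₂ hm₂ => ?_).trans ?_)
  · exact (single_blockPos_apply q ..).trans (if_neg fun h => hm₂ h.1)
  · exact (single_blockPos_apply q ..).trans (by simp)

lemma measure_pi_uniform_eq_zero {N : ℕ → ℕ} [∀ m, NeZero (N m)] {B : ℕ → Set ℕ} {u : ℕ → ℝ}
    (hu : Filter.Tendsto u Filter.atTop (nhds 0))
    (hB : ∀ m, ∀ S : Finset ℕ, (S : Set ℕ) ⊆ B m → (S.card : ℝ) ≤ u m * N m) :
    Measure.infinitePi (fun m => (PMF.uniformOfFintype (Fin (N m))).toMeasure)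
      {ω | ∀ m, (ω m : ℕ) ∈ B m} = 0 := by
  classical
  have hle : ∀ m, Measure.infinitePi (fun m => (PMF.uniformOfFintype (Fin (N m))).toMeasure)
      {ω | ∀ m, (ω m : ℕ) ∈ B m} ≤ ENNReal.ofReal (u m) := by
    intro m
    have hN : (0 : ℝ) < N m := Nat.cast_pos.2 (NeZero.pos _)
    set S : Finset (Fin (N m)) := Finset.univ.filter fun a => (a : ℕ) ∈ B m
    calc _ ≤ Measure.infinitePi (fun m => (PMF.uniformOfFintype (Fin (N m))).toMeasure)
          (Function.eval m ⁻¹' (S : Set (Fin (N m)))) :=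
          measure_mono fun ω hω => by simpa [S] using hω m
      _ = (PMF.uniformOfFintype (Fin (N m))).toMeasure S :=
          (measurePreserving_eval_infinitePi _ m).measure_preimage
            (MeasurableSet.of_discrete).nullMeasurableSet
      _ = S.card / N m := by
          refine (PMF.toMeasure_uniformOfFintype_apply (S : Set (Fin (N m))) .of_discrete).trans ?_
          simp
      _ ≤ ENNReal.ofReal (u m) := by
          have h1 := hB m (S.map Fin.valEmbedding) (by intro a; simp +contextual [S]; aesop)
          rw [Finset.card_map, ← div_le_iff₀ hN] at h1
          refine le_trans (le_of_eq ?_) (ENNReal.ofReal_le_ofReal h1)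
          rw [ENNReal.ofReal_div_of_pos hN, ENNReal.ofReal_natCast, ENNReal.ofReal_natCast]
  have hlim := ENNReal.tendsto_ofReal hu
  rw [ENNReal.ofReal_zero] at hlim
  exact le_antisymm (ge_of_tendsto' hlim hle) zero_le

lemma haarNull_not_propertyKSeq {p : ℝ} (hp : 1 < p) [Fact (1 ≤ ENNReal.ofReal p)] (n : ℕ)
    [MeasurableSpace (Fin n → lp (fun _ : ℕ => ℝ) (ENNReal.ofReal p))]
    [BorelSpace (Fin n → lp (fun _ : ℕ => ℝ) (ENNReal.ofReal p))] :
    HaarNull {x : Fin n → lp (fun _ : ℕ => ℝ) (ENNReal.ofReal p) |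
      ¬ PropertyKSeq p n (fun i k => x i k)} := by
  obtain ⟨δ, hδ, hG⟩ := exists_pos_forall_mem_Gset hp n
  obtain ⟨K, hK⟩ := exists_nat_gt ((2 : ℝ) ^ p)
  have h2 : (0 : ℝ) < 2 ^ p := by positivity
  have hK0 : (0 : ℝ) < K := h2.trans hK
  have : ∀ m : ℕ, NeZero (K ^ m) := fun m => ⟨pow_ne_zero m (Nat.cast_pos.1 hK0).ne'⟩
  let μ := Measure.infinitePi fun m => (PMF.uniformOfFintype (Fin (K ^ m))).toMeasure
  let T : (∀ m, Fin (K ^ m)) → Fin n → lp (fun _ : ℕ => ℝ) (ENNReal.ofReal p) :=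
    fun ω => sparseTuple _ n fun m => ω m
  have hT : Measurable T := ((continuous_sparseTuple _ n).comp (continuous_pi fun m =>
    continuous_of_discreteTopology.comp (continuous_apply m))).measurable
  refine ⟨μ.map T, Measure.isProbabilityMeasure_map hT.aemeasurable, fun x => ?_⟩
  have hmeas : MeasurableSet {y : Fin n → lp (fun _ : ℕ => ℝ) (ENNReal.ofReal p) |
      ¬ PropertyKSeq p n (fun i k => y i k)} :=
    (isOpen_propertyKSeq hp n).isClosed_compl.measurableSet
  rw [Set.image_add_left, Measure.map_apply hT
    ((continuous_const_add (-x)).measurable hmeas), ← nonpos_iff_eq_zero]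
  set C := (∑ i, ‖(-x) i‖ ^ p) / δ ^ p with hC
  refine (measure_mono ?_).trans_eq (measure_pi_uniform_eq_zero
    (B := fun m => largeBlocks ((1 / 2) ^ m * δ) (fun i k => (-x) i k) m)
    (u := fun m => C * (2 ^ p / K) ^ m) ?_ ?_)
  · intro ω hω m
    by_contra hm
    exact hω (propertyKSeq_add (by positivity) hG hm
      fun i j => sparseTuple_apply _ n (fun m => ω m) m i j)
  · simpa using (tendsto_pow_atTop_nhds_zero_of_lt_one (by positivity)
      ((div_lt_one hK0).2 hK)).const_mul C
  · intro m S hS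
    have h3 := card_largeBlocks_le hp (by positivity) (-x) m hS
    have h4 : (((1 / 2 : ℝ) ^ m * δ) ^ p) = δ ^ p / (2 ^ p) ^ m := by
      rw [Real.mul_rpow (by positivity) hδ.le, ← Real.rpow_pow_comm (by positivity),
        Real.div_rpow zero_le_one two_pos.le, Real.one_rpow, div_pow, one_pow]
      ring
    have h5 : 0 < δ ^ p := by positivity
    have h6 : C * (2 ^ p / K) ^ m * ((K ^ m : ℕ) : ℝ) = C * (2 ^ p) ^ m := by
      push_cast
      rw [div_pow]
      field_simp
    rw [h6, hC, div_mul_eq_mul_div, le_div_iff₀ h5]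
    rwa [h4, ← mul_div_assoc, div_le_iff₀ (by positivity)] at h3

-- test lp coercion and instances

/-- The set of `n`-tuples in `(ℓ_p)^n` without Property K is closed,
Haar null and nowhere dense. -/
theorem stmt10 (p : ℝ) (hp : 1 < p) [Fact (1 ≤ ENNReal.ofReal p)] (n : ℕ)
    [MeasurableSpace (Fin n → lp (fun _ : ℕ => ℝ) (ENNReal.ofReal p))]
    [BorelSpace (Fin n → lp (fun _ : ℕ => ℝ) (ENNReal.ofReal p))] :
    IsClosed {x : Fin n → lp (fun _ : ℕ => ℝ) (ENNReal.ofReal p) |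
      ¬ PropertyKSeq p n (fun i k => x i k)} ∧
    HaarNull {x : Fin n → lp (fun _ : ℕ => ℝ) (ENNReal.ofReal p) |
      ¬ PropertyKSeq p n (fun i k => x i k)} ∧
    IsNowhereDense {x : Fin n → lp (fun _ : ℕ => ℝ) (ENNReal.ofReal p) |
      ¬ PropertyKSeq p n (fun i k => x i k)} := by
  have hcl := (isOpen_propertyKSeq hp n).isClosed_compl
  exact ⟨hcl, haarNull_not_propertyKSeq hp n,
    hcl.isNowhereDense_iff.2 (dense_propertyKSeq hp n).interior_compl⟩
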